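/- Let 0 ≤ s ≤ r ≤ n−2 with r ≢ s (mod 2), and let α ∈ D_s(M_n). Then α ∈ ⟨D_r(M_n)⟩ if and only if α has a singleton upper block of nesting depth at most (r−s−1)/2 and a singleton lower block of nesting depth at most (r−s−1)/2. -/

import Mathlib

/-!
Partial Brauer diagrams on `n` points are formalized as set partitions
(equivalence relations, i.e. `Setoid`s) of the vertex set
`{1,…,n} ∪ {1',…,n'}`, encoded as `Fin n ⊕ Fin n`
(`Sum.inl i` is the upper vertex `i`, `Sum.inr i` is the lower vertex `i'`),
all of whose blocks have size at most 2.  The product of two diagrams is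
defined via connectivity (paths) in the product graph, and the involution `*`
by interchanging the two rows of vertices.
-/

noncomputable section

open scoped Classical

/-- Vertices of a diagram on `n` points. -/
abbrev PBV (n : ℕ) := Fin n ⊕ Fin n

/-- A "diagram candidate": an arbitrary set partition of the vertices. -/
abbrev Dgm (n : ℕ) := Setoid (PBV n)

/-- The equivalence relation ("joined by a path") generated by a relation. -/
inductive RGen {V : Type*} (r : V → V → Prop) : V → V → Prop
  | rel {x y : V} : r x y → RGen r x y
  | refl (x : V) : RGen r x x
  | symm {x y : V} : RGen r x y → RGen r y x
  | trans {x y z : V} : RGen r x y → RGen r y z → RGen r x z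

namespace Dgm

variable {n : ℕ}

/-- Vertices of the product graph: top, middle and bottom rows. -/
abbrev V3 (n : ℕ) := Fin n ⊕ (Fin n ⊕ Fin n)

/-- The first factor occupies the top and middle rows of the product graph. -/
def topMid : PBV n → V3 n
  | Sum.inl i => Sum.inl i
  | Sum.inr i => Sum.inr (Sum.inl i)

/-- The second factor occupies the middle and bottom rows of the product graph. -/
def midBot : PBV n → V3 n
  | Sum.inl i => Sum.inr (Sum.inl i)
  | Sum.inr i => Sum.inr (Sum.inr i)

/-- The product diagram occupies the top and bottom rows of the product graph. -/
def topBot : PBV n → V3 n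
  | Sum.inl i => Sum.inl i
  | Sum.inr i => Sum.inr (Sum.inr i)

/-- The edges of the product graph `Γ(α, β)`. -/
def prodEdges (α β : Dgm n) (x y : V3 n) : Prop :=
  (∃ a b : PBV n, α.r a b ∧ x = topMid a ∧ y = topMid b) ∨
  (∃ a b : PBV n, β.r a b ∧ x = midBot a ∧ y = midBot b)

/-- The product of two diagrams: two vertices lie in the same block of `α β`
iff they are joined by a path in the product graph `Γ(α, β)`. -/
def pmul (α β : Dgm n) : Dgm n where
  r x y := RGen (prodEdges α β) (topBot x) (topBot y)
  iseqv := ⟨fun _ => RGen.refl _, fun h => h.symm, fun h₁ h₂ => h₁.trans h₂⟩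

/-- Interchanging the upper and the lower vertices. -/
def swapUD : PBV n → PBV n
  | Sum.inl i => Sum.inr i
  | Sum.inr i => Sum.inl i

/-- The involution `α ↦ α*` (reflection in a horizontal axis). -/
def pstar (α : Dgm n) : Dgm n := Setoid.comap swapUD α

/-- All blocks of `α` have size at most 2. -/
def IsPB (α : Dgm n) : Prop :=
  ∀ x y z : PBV n, α.r x y → α.r x z → x = y ∨ x = z ∨ y = z

/-- The partial Brauer monoid `PB_n` (as a set of diagrams). -/
def PBset (n : ℕ) : Set (Dgm n) := {α | IsPB α}

/-- The position of a vertex in the linear order `1 < 2 < ⋯ < n < n' < ⋯ < 1'`. -/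
def vpos : PBV n → ℕ
  | Sum.inl i => (i : ℕ)
  | Sum.inr i => 2 * n - 1 - (i : ℕ)

/-- Planarity: no two blocks cross in the order `1 < ⋯ < n < n' < ⋯ < 1'`. -/
def IsPlanar (α : Dgm n) : Prop :=
  ∀ a b c d : PBV n, α.r a b → α.r c d →
    vpos a < vpos c → vpos c < vpos b → vpos b < vpos d → False

/-- The Motzkin monoid `M_n` (as a set of diagrams). -/
def Mset (n : ℕ) : Set (Dgm n) := {α | IsPB α ∧ IsPlanar α}

/-- The domain of `α`: upper points lying in a transversal block. -/
def domSet (α : Dgm n) : Set (Fin n) := {i | ∃ j, α.r (Sum.inl i) (Sum.inr j)}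

/-- The codomain of `α`: lower points lying in a transversal block. -/
def codomSet (α : Dgm n) : Set (Fin n) := {i | ∃ j, α.r (Sum.inr i) (Sum.inl j)}

/-- The rank of a diagram: the number of its transversal blocks (for a diagram
with blocks of size at most 2, each transversal block contains exactly one
upper point, so this is the size of the domain). -/
def prank (α : Dgm n) : ℕ := (domSet α).ncard

/-- `α` is an idempotent. -/
def IsIdpt (α : Dgm n) : Prop := pmul α α = α

/-- `α` is a projection. -/
def IsProj (α : Dgm n) : Prop := pmul α α = α ∧ pstar α = α

/-- The D-class `D_r(PB_n)`. -/
def DPB (n r : ℕ) : Set (Dgm n) := {α | α ∈ PBset n ∧ prank α = r}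

/-- The ideal `I_r(PB_n)`. -/
def IPB (n r : ℕ) : Set (Dgm n) := {α | α ∈ PBset n ∧ prank α ≤ r}

/-- The D-class `D_r(M_n)`. -/
def DM (n r : ℕ) : Set (Dgm n) := {α | α ∈ Mset n ∧ prank α = r}

/-- The ideal `I_r(M_n)`. -/
def IM (n r : ℕ) : Set (Dgm n) := {α | α ∈ Mset n ∧ prank α ≤ r}

end Dgm

/-- Membership in the closure of a subset under a binary operation. -/
inductive MClo {γ : Type*} (m : γ → γ → γ) (X : Set γ) : γ → Prop
  | base {x : γ} : x ∈ X → MClo m X x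
  | mul {x y : γ} : MClo m X x → MClo m X y → MClo m X (m x y)

/-- The subsemigroup `⟨X⟩` generated by the subset `X`. -/
def genSet {γ : Type*} (m : γ → γ → γ) (X : Set γ) : Set γ := {x | MClo m X x}

/-- The rank of `T`: the least size of a generating set. -/
noncomputable def rnk {γ : Type*} (m : γ → γ → γ) (T : Set γ) : ℕ :=
  sInf {k | ∃ X : Finset γ, X.card = k ∧ genSet m ↑X = T}

/-- The idempotent rank of `T`: the least size of a generating set consisting
of idempotents. -/
noncomputable def idrnk {γ : Type*} (m : γ → γ → γ) (T : Set γ) : ℕ :=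
  sInf {k | ∃ X : Finset γ, X.card = k ∧ (∀ x ∈ X, m x x = x) ∧ genSet m ↑X = T}

/-- `T` is idempotent-generated. -/
def IdptGen {γ : Type*} (m : γ → γ → γ) (T : Set γ) : Prop :=
  genSet m {x ∈ T | m x x = x} = T

open Dgm
/-- `a(m)`: `a(0) = a(1) = 1` and `a(m) = a(m-1) + (m-1)·a(m-2)`. -/
def aSeq : ℕ → ℕ
  | 0 => 1
  | 1 => 1
  | (m + 2) => aSeq (m + 1) + (m + 1) * aSeq m

/-- The double factorial `k!!`, with the convention `k!! = 0` for even `k ≥ 0`. -/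
def oddDF : ℕ → ℕ
  | 0 => 0
  | 1 => 1
  | (k + 2) => (k + 2) * oddDF k

namespace Dgm

variable {n : ℕ}

/-- `{x}` is a singleton upper block of `α`. -/
def UpperSingleton (α : Dgm n) (x : Fin n) : Prop :=
  ∀ y : PBV n, α.r (Sum.inl x) y → y = Sum.inl x

/-- `{x'}` is a singleton lower block of `α`. -/
def LowerSingleton (α : Dgm n) (x : Fin n) : Prop :=
  ∀ y : PBV n, α.r (Sum.inr x) y → y = Sum.inr x

/-- The upper point `x` is nested: some upper block `{u,v}` has `u < x < v`. -/
def UpperNested (α : Dgm n) (x : Fin n) : Prop :=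
  ∃ u v : Fin n, α.r (Sum.inl u) (Sum.inl v) ∧ u < x ∧ x < v

/-- The lower point `x'` is nested: some lower block `{u',v'}` has `u < x < v`. -/
def LowerNested (α : Dgm n) (x : Fin n) : Prop :=
  ∃ u v : Fin n, α.r (Sum.inr u) (Sum.inr v) ∧ u < x ∧ x < v

/-- `α` has no unnested singleton (upper or lower) block. -/
def NoUnnestedSingleton (α : Dgm n) : Prop :=
  (∀ x, UpperSingleton α x → UpperNested α x) ∧
  (∀ x, LowerSingleton α x → LowerNested α x)

/-- A chain of `d` nested upper hooks of `α` around the upper point `x`: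
`u_{d-1} < ⋯ < u_0 < x < v_0 < ⋯ < v_{d-1}` with each `{u_i, v_i}` a block.
The singleton upper block `{x}` has nesting depth at most `k` iff there is no
such chain of length `k + 1`. -/
def UpperHookChain (α : Dgm n) (x : Fin n) (d : ℕ) : Prop :=
  ∃ u v : Fin d → Fin n,
    (∀ i, α.r (Sum.inl (u i)) (Sum.inl (v i))) ∧
    (∀ i, u i < x ∧ x < v i) ∧ StrictAnti u ∧ StrictMono v

/-- A chain of `d` nested lower hooks of `α` around the lower point `x'`. -/
def LowerHookChain (α : Dgm n) (x : Fin n) (d : ℕ) : Prop :=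
  ∃ u v : Fin d → Fin n,
    (∀ i, α.r (Sum.inr (u i)) (Sum.inr (v i))) ∧
    (∀ i, u i < x ∧ x < v i) ∧ StrictAnti u ∧ StrictMono v

/-- `λ_A`: the planar diagram joining the `k`-th smallest element of `A`
(upper) to `k` (lower), all other blocks being singletons. -/
def lamd (A : Finset (Fin n)) : Dgm n :=
  Setoid.ker (fun x : PBV n =>
    match x with
    | Sum.inl a =>
        if ha : a ∈ A then
          (Sum.inr (((A.orderIsoOfFin rfl).symm ⟨a, ha⟩ : Fin A.card) : ℕ) : ℕ ⊕ ℕ)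
        else Sum.inl (a : ℕ)
    | Sum.inr j => Sum.inr (j : ℕ))

/-- `ρ_A = (λ_A)*`. -/
def rhod (A : Finset (Fin n)) : Dgm n := pstar (lamd A)

/-- The diagram whose 2-element blocks are exactly `{i, (π i)'}` for `i < r`. -/
def permDgm (n r : ℕ) (π : Equiv.Perm (Fin r)) : Dgm n :=
  Setoid.ker (fun x : PBV n =>
    match x with
    | Sum.inl a =>
        if h : (a : ℕ) < r then (Sum.inr ((π ⟨(a : ℕ), h⟩ : Fin r) : ℕ) : ℕ ⊕ ℕ)
        else Sum.inl (a : ℕ)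
    | Sum.inr j => Sum.inr (j : ℕ))

/-- The set `S_{[r]} ⊆ PB_n`. -/
def SBr (n r : ℕ) : Set (Dgm n) := {γ | ∃ π : Equiv.Perm (Fin r), γ = permDgm n r π}

/-- The domain of `α` as a `Finset`. -/
def domFinset (α : Dgm n) : Finset (Fin n) :=
  Finset.univ.filter fun i => i ∈ domSet α

/-- The codomain of `α` as a `Finset`. -/
def codomFinset (α : Dgm n) : Finset (Fin n) :=
  Finset.univ.filter fun i => i ∈ codomSet α

/-- `A ⊆ {1,…,n}` is cosparse: its complement contains no two consecutive
elements. -/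
def CosparseS (A : Set (Fin n)) : Prop :=
  ∀ i j : Fin n, i ∉ A → j ∉ A → (j : ℕ) ≠ (i : ℕ) + 1

/-- `id_A`: the diagram with blocks `{a, a'}` for `a ∈ A`, all other blocks
being singletons. -/
def idd (A : Set (Fin n)) : Dgm n :=
  Setoid.ker (fun x : PBV n =>
    match x with
    | Sum.inl a => if a ∈ A then (Sum.inr (a : ℕ) : ℕ ⊕ ℕ) else Sum.inl (a : ℕ)
    | Sum.inr j => Sum.inr (j : ℕ))

end Dgm

namespace Dgm

variable {n : ℕ}

theorem pmul_eq (α β γ : Dgm n)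
    (hsub : ∀ a b, γ.r a b → RGen (prodEdges α β) (topBot a) (topBot b))
    (P : PBV n → V3 n → Prop)
    (hα : ∀ c a b, α.r a b → P c (topMid a) → P c (topMid b))
    (hβ : ∀ c a b, β.r a b → P c (midBot a) → P c (midBot b))
    (hP : ∀ c b, P c (topBot b) ↔ γ.r c b) : γ = pmul α β := by
  have key : ∀ x y, RGen (prodEdges α β) x y → ∀ c, P c x ↔ P c y := by
    intro x y h
    induction h with
    | rel h =>
      intro c
      rcases h with ⟨a, b, h, rfl, rfl⟩ | ⟨a, b, h, rfl, rfl⟩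
      · exact ⟨hα c a b h, hα c b a (α.iseqv.symm h)⟩
      · exact ⟨hβ c a b h, hβ c b a (β.iseqv.symm h)⟩
    | refl x => intro c; rfl
    | symm _ ih => intro c; exact (ih c).symm
    | trans _ _ ih1 ih2 => intro c; exact (ih1 c).trans (ih2 c)
  apply Setoid.ext
  intro a b
  constructor
  · intro h; exact hsub a b h
  · intro h
    have h1 := key _ _ h a
    rw [hP, hP] at h1
    exact h1.1 (γ.iseqv.refl a)

/-! ### Star -/

theorem pstar_r (α : Dgm n) (a b : PBV n) : (pstar α).r a b ↔ α.r (swapUD a) (swapUD b) := Iff.rfl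

theorem swap_swap (a : PBV n) : swapUD (swapUD a) = a := by cases a <;> rfl

theorem pstar_pstar (α : Dgm n) : pstar (pstar α) = α := by
  apply Setoid.ext
  intro a b
  change α.r (swapUD (swapUD a)) (swapUD (swapUD b)) ↔ α.r a b
  rw [swap_swap, swap_swap]

def flip3 : V3 n → V3 n
  | Sum.inl i => Sum.inr (Sum.inr i)
  | Sum.inr (Sum.inl i) => Sum.inr (Sum.inl i)
  | Sum.inr (Sum.inr i) => Sum.inl i

theorem flip3_flip3 (a : V3 n) : flip3 (flip3 a) = a := by
  rcases a with a | a | a <;> rfl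

theorem flip_topMid (a : PBV n) : flip3 (topMid a) = midBot (swapUD a) := by cases a <;> rfl
theorem flip_midBot (a : PBV n) : flip3 (midBot a) = topMid (swapUD a) := by cases a <;> rfl
theorem flip_topBot (a : PBV n) : flip3 (topBot a) = topBot (swapUD a) := by cases a <;> rfl

theorem RGen_flip (α β : Dgm n) (x y : V3 n) (h : RGen (prodEdges α β) x y) :
    RGen (prodEdges (pstar β) (pstar α)) (flip3 x) (flip3 y) := by
  induction h with
  | rel h =>
    apply RGen.rel
    rcases h with ⟨a, b, h, rfl, rfl⟩ | ⟨a, b, h, rfl, rfl⟩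
    · right
      refine ⟨swapUD a, swapUD b, ?_, flip_topMid a, flip_topMid b⟩
      rw [pstar_r, swap_swap, swap_swap]; exact h
    · left
      refine ⟨swapUD a, swapUD b, ?_, flip_midBot a, flip_midBot b⟩
      rw [pstar_r, swap_swap, swap_swap]; exact h
  | refl x => exact RGen.refl _
  | symm _ ih => exact ih.symm
  | trans _ _ ih1 ih2 => exact ih1.trans ih2

theorem pstar_pmul (α β : Dgm n) : pstar (pmul α β) = pmul (pstar β) (pstar α) := by
  apply Setoid.ext
  intro a b
  change RGen (prodEdges α β) (topBot (swapUD a)) (topBot (swapUD b)) ↔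
    RGen (prodEdges (pstar β) (pstar α)) (topBot a) (topBot b)
  constructor
  · intro h
    have := RGen_flip _ _ _ _ h
    rwa [flip_topBot, flip_topBot, swap_swap, swap_swap] at this
  · intro h
    have := RGen_flip _ _ _ _ h
    rwa [flip_topBot, flip_topBot, pstar_pstar, pstar_pstar] at this

theorem vpos_swap (a : PBV n) : vpos (swapUD a) + vpos a = 2 * n - 1 := by
  rcases a with a | a <;> simp only [swapUD, vpos] <;> omega

theorem Mset_star {α : Dgm n} (h : α ∈ Mset n) : pstar α ∈ Mset n := by
  obtain ⟨h1, h2⟩ := h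
  constructor
  · intro x y z hxy hxz
    have inj : ∀ a b : PBV n, swapUD a = swapUD b → a = b := by
      intro a b h
      have := congrArg swapUD h
      rwa [swap_swap, swap_swap] at this
    rcases h1 _ _ _ hxy hxz with h | h | h
    · exact Or.inl (inj _ _ h)
    · exact Or.inr (Or.inl (inj _ _ h))
    · exact Or.inr (Or.inr (inj _ _ h))
  · intro a b c d hab hcd h3 h4 h5
    have := vpos_swap a
    have := vpos_swap b
    have := vpos_swap c
    have := vpos_swap d
    exact h2 _ _ _ _ (α.iseqv.symm hcd) (α.iseqv.symm hab) (by omega) (by omega) (by omega)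

theorem codom_eq (α : Dgm n) : domSet (pstar α) = codomSet α := rfl
theorem dom_eq (α : Dgm n) : codomSet (pstar α) = domSet α := rfl

/-- functional facts for PB -/
theorem lr_inj {α : Dgm n} (h : IsPB α) {u v : Fin n} {j : Fin n}
    (h1 : α.r (Sum.inl u) (Sum.inr j)) (h2 : α.r (Sum.inl v) (Sum.inr j)) : u = v := by
  rcases h _ _ _ (α.iseqv.symm h1) (α.iseqv.symm h2) with h | h | h
  · cases h
  · cases h
  · exact Sum.inl.inj h

theorem lr_fun {α : Dgm n} (h : IsPB α) {u : Fin n} {i j : Fin n}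
    (h1 : α.r (Sum.inl u) (Sum.inr i)) (h2 : α.r (Sum.inl u) (Sum.inr j)) : i = j := by
  rcases h _ _ _ h1 h2 with h | h | h
  · cases h
  · cases h
  · exact Sum.inr.inj h

theorem ll_lr {α : Dgm n} (h : IsPB α) {u v : Fin n} {j : Fin n}
    (h1 : α.r (Sum.inl u) (Sum.inl v)) (h2 : α.r (Sum.inl u) (Sum.inr j)) : u = v := by
  rcases h _ _ _ h1 h2 with h | h | h
  · exact Sum.inl.inj h
  · cases h
  · cases h

theorem ll_ll {α : Dgm n} (h : IsPB α) {u v w : Fin n}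
    (h1 : α.r (Sum.inl u) (Sum.inl v)) (h2 : α.r (Sum.inl u) (Sum.inl w)) :
    u = v ∨ u = w ∨ v = w := by
  rcases h _ _ _ h1 h2 with h | h | h
  · exact Or.inl (Sum.inl.inj h)
  · exact Or.inr (Or.inl (Sum.inl.inj h))
  · exact Or.inr (Or.inr (Sum.inl.inj h))

theorem prank_star {α : Dgm n} (h : IsPB α) : prank (pstar α) = prank α := by
  unfold prank
  rw [codom_eq]
  symm
  refine Set.ncard_congr (fun i hi => Classical.choose hi) ?_ ?_ ?_
  · intro i hi
    exact ⟨i, α.iseqv.symm (Classical.choose_spec hi)⟩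
  · intro a b ha hb hab
    have h1 := Classical.choose_spec ha
    have h2 := Classical.choose_spec hb
    have hab : Classical.choose ha = Classical.choose hb := hab
    rw [← hab] at h2
    exact lr_inj h h1 h2
  · rintro b ⟨a, hab⟩
    have ha : a ∈ domSet α := ⟨b, α.iseqv.symm hab⟩
    exact ⟨a, ha, lr_fun h (Classical.choose_spec ha) (α.iseqv.symm hab)⟩

theorem DM_star {α : Dgm n} {r : ℕ} (h : α ∈ DM n r) : pstar α ∈ DM n r :=
  ⟨Mset_star h.1, by rw [prank_star h.1.1]; exact h.2⟩

theorem gen_star {α : Dgm n} {r : ℕ} (h : α ∈ genSet (pmul (n := n)) (DM n r)) :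
    pstar α ∈ genSet (pmul (n := n)) (DM n r) := by
  induction h with
  | base h => exact MClo.base (DM_star h)
  | mul _ _ ih1 ih2 => rw [pstar_pmul]; exact MClo.mul ih2 ih1

theorem gen_trans {X Y : Set (Dgm n)} (h : X ⊆ genSet (pmul (n := n)) Y) {α : Dgm n}
    (hα : α ∈ genSet (pmul (n := n)) X) : α ∈ genSet (pmul (n := n)) Y := by
  induction hα with
  | base h' => exact h h'
  | mul _ _ ih1 ih2 => exact MClo.mul ih1 ih2

theorem US_star (α : Dgm n) (x : Fin n) : UpperSingleton (pstar α) x ↔ LowerSingleton α x := by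
  constructor
  · intro h y hy
    have := h (swapUD y) (by rw [pstar_r, swap_swap]; exact hy)
    have := congrArg swapUD this
    rwa [swap_swap] at this
  · intro h y hy
    have := h (swapUD y) hy
    have := congrArg swapUD this
    rwa [swap_swap] at this

theorem LS_star (α : Dgm n) (x : Fin n) : LowerSingleton (pstar α) x ↔ UpperSingleton α x := by
  rw [← US_star, pstar_pstar]

/-! ### planar facts -/

theorem hook_trans {α : Dgm n} (h : IsPlanar α) {u v x y : Fin n}
    (h1 : α.r (Sum.inl u) (Sum.inl v)) (h2 : α.r (Sum.inl x) (Sum.inr y))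
    (h3 : u < x) (h4 : x < v) : False := by
  apply h _ _ _ _ h1 h2 <;> simp only [vpos] <;> omega

theorem trans_mono {α : Dgm n} (h : α ∈ Mset n) {u v x y : Fin n}
    (h1 : α.r (Sum.inl u) (Sum.inr x)) (h2 : α.r (Sum.inl v) (Sum.inr y)) :
    u < v ↔ x < y := by
  have key : ∀ u v x y : Fin n, α.r (Sum.inl u) (Sum.inr x) → α.r (Sum.inl v) (Sum.inr y) →
      u < v → x < y := by
    intro u v x y h1 h2 h3
    rcases lt_trichotomy x y with h4 | h4 | h4
    · exact h4
    · subst h4; have := lr_inj h.1 h1 h2; omega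
    · exfalso; apply h.2 _ _ _ _ h1 h2 <;> simp only [vpos] <;> omega
  constructor
  · exact key _ _ _ _ h1 h2
  · intro h3
    rcases lt_trichotomy u v with h4 | h4 | h4
    · exact h4
    · subst h4; have := lr_fun h.1 h1 h2; omega
    · have := key _ _ _ _ h2 h1 h4; omega

theorem hook_hook {α : Dgm n} (h : IsPlanar α) {u v x y : Fin n}
    (h1 : α.r (Sum.inl u) (Sum.inl v)) (h2 : α.r (Sum.inl x) (Sum.inl y))
    (h3 : u < x) (h4 : x < v) (h5 : v < y) : False := by
  apply h _ _ _ _ h1 h2 <;> simp only [vpos] <;> omega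

/-! ### Opened diagrams -/

/-- partial order isomorphism -/
def POI (T : Fin n → Fin n → Prop) : Prop :=
  ∀ u v i j, T u i → T v j → (u < v ↔ i < j)

theorem POI.fn {T : Fin n → Fin n → Prop} (h : POI T) {u i j} (h1 : T u i) (h2 : T u j) :
    i = j := by
  have := h _ _ _ _ h1 h2
  have := h _ _ _ _ h2 h1
  simp at *
  omega

theorem POI.inj {T : Fin n → Fin n → Prop} (h : POI T) {u v i} (h1 : T u i) (h2 : T v i) :
    u = v := by
  have := h _ _ _ _ h1 h2
  have := h _ _ _ _ h2 h1
  simp at *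
  omega

def opnR (α : Dgm n) (T : Fin n → Fin n → Prop) : PBV n → PBV n → Prop
  | Sum.inl u, Sum.inl v => u = v ∨ (α.r (Sum.inl u) (Sum.inl v) ∧ (∀ i, ¬ T u i) ∧ ∀ i, ¬ T v i)
  | Sum.inl u, Sum.inr j => T u j
  | Sum.inr j, Sum.inl u => T u j
  | Sum.inr i, Sum.inr j => i = j

def opn (α : Dgm n) (T : Fin n → Fin n → Prop) (hT : POI T) : Dgm n where
  r := opnR α T
  iseqv := by
    refine ⟨?_, ?_, ?_⟩
    · rintro (a | a)
      · exact Or.inl rfl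
      · exact rfl
    · rintro (a | a) (b | b) h
      · rcases h with h | ⟨h1, h2, h3⟩
        · exact Or.inl h.symm
        · exact Or.inr ⟨α.iseqv.symm h1, h3, h2⟩
      · exact h
      · exact h
      · exact Eq.symm h
    · rintro (a | a) (b | b) (c | c) h h'
      · rcases h with rfl | ⟨h1, h2, h3⟩
        · exact h'
        · rcases h' with rfl | ⟨h4, h5, h6⟩
          · exact Or.inr ⟨h1, h2, h3⟩
          · exact Or.inr ⟨α.iseqv.trans h1 h4, h2, h6⟩
      · rcases h with rfl | ⟨h1, h2, h3⟩
        · exact h'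
        · exact absurd h' (h3 c)
      · exact Or.inl (hT.inj h h')
      · have h' : b = c := h'
        subst h'; exact h
      · rcases h' with rfl | ⟨h1, h2, h3⟩
        · exact h
        · exact absurd h (h2 a)
      · exact hT.fn h h'
      · have h : a = b := h
        subst h; exact h'
      · have h : a = b := h
        subst h; exact h'

theorem opn_dom (α : Dgm n) (T : Fin n → Fin n → Prop) (hT : POI T) :
    domSet (opn α T hT) = {u | ∃ i, T u i} := rfl

theorem opn_Mset {α : Dgm n} (hα : α ∈ Mset n) (T : Fin n → Fin n → Prop) (hT : POI T)
    (hn : ∀ u v x i, α.r (Sum.inl u) (Sum.inl v) → (∀ i, ¬ T u i) → T x i →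
      u < x → x < v → False) : opn α T hT ∈ Mset n := by
  constructor
  · rintro (a | a) (b | b) (c | c) h h'
    · rcases h with rfl | ⟨h1, h2, h3⟩
      · exact Or.inl rfl
      · rcases h' with rfl | ⟨h4, h5, h6⟩
        · exact Or.inr (Or.inl rfl)
        · rcases ll_ll hα.1 h1 h4 with h | h | h <;> simp [h]
    · rcases h with rfl | ⟨h1, h2, h3⟩
      · exact Or.inl rfl
      · exact absurd h' (h2 _)
    · rcases h' with rfl | ⟨h1, h2, h3⟩
      · exact Or.inr (Or.inl rfl)
      · exact absurd h (h2 _)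
    · exact Or.inr (Or.inr (congrArg Sum.inr (hT.fn h h')))
    · exact Or.inr (Or.inr (congrArg Sum.inl (hT.inj h h')))
    · exact Or.inr (Or.inl (congrArg Sum.inr h'))
    · exact Or.inl (congrArg Sum.inr h)
    · exact Or.inl (congrArg Sum.inr h)
  · rintro (a | a) (b | b) (c | c) (d | d) h h' h3 h4 h5 <;> simp only [vpos] at h3 h4 h5 <;>
      try omega
    · rcases h with rfl | ⟨h1, h2, h2'⟩
      · omega
      · rcases h' with rfl | ⟨h6, h7, h8⟩
        · omega
        · exact hook_hook hα.2 h1 h6 h3 h4 h5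
    · rcases h with rfl | ⟨h1, h2, h2'⟩
      · omega
      · exact hn _ _ _ _ h1 h2 h' h3 h4
    · have := hT _ _ _ _ h h'
      omega
    · have h' : c = d := h'
      omega
    · have h : a = b := h
      omega


/-! ### Pullbacks -/

def GR (T : Fin n → Fin n → Prop) : PBV n → PBV n → Prop
  | Sum.inl i, Sum.inl u => T u i
  | Sum.inr i, Sum.inr j => i = j
  | _, _ => False

theorem GR.fn {T : Fin n → Fin n → Prop} (h : POI T) {a b c : PBV n} (h1 : GR T a b)
    (h2 : GR T a c) : b = c := by
  rcases a with a | a <;> rcases b with b | b <;> rcases c with c | c <;>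
    simp only [GR] at h1 h2
  · rw [h.inj h1 h2]
  · rw [← h1, ← h2]

theorem GR.inj {T : Fin n → Fin n → Prop} (h : POI T) {a b c : PBV n} (h1 : GR T a c)
    (h2 : GR T b c) : a = b := by
  rcases a with a | a <;> rcases b with b | b <;> rcases c with c | c <;>
    simp only [GR] at h1 h2
  · rw [h.fn h1 h2]
  · rw [h1, h2]

theorem GR.vp {T : Fin n → Fin n → Prop} (h : POI T) {a b c d : PBV n} (h1 : GR T a c)
    (h2 : GR T b d) (h3 : vpos a < vpos b) : vpos c < vpos d := by
  rcases a with a | a <;> rcases b with b | b <;> rcases c with c | c <;> rcases d with d | d <;>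
    simp only [GR] at h1 h2 <;> simp only [vpos] at h3 ⊢
  · have := h _ _ _ _ h1 h2
    omega
  · omega
  · omega
  · subst h1 h2; exact h3

def pul (α : Dgm n) (T : Fin n → Fin n → Prop) (hT : POI T) : Dgm n where
  r a b := a = b ∨ ∃ a' b', GR T a a' ∧ GR T b b' ∧ α.r a' b'
  iseqv := by
    refine ⟨fun a => Or.inl rfl, ?_, ?_⟩
    · rintro a b (h | ⟨a', b', h1, h2, h3⟩)
      · exact Or.inl h.symm
      · exact Or.inr ⟨b', a', h2, h1, α.iseqv.symm h3⟩
    · rintro a b c (rfl | ⟨a', b', h1, h2, h3⟩) h'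
      · exact h'
      · rcases h' with rfl | ⟨b'', c', h4, h5, h6⟩
        · exact Or.inr ⟨a', b', h1, h2, h3⟩
        · have := GR.fn hT h2 h4
          subst this
          exact Or.inr ⟨a', c', h1, h5, α.iseqv.trans h3 h6⟩

theorem pul_Mset {α : Dgm n} (hα : α ∈ Mset n) (T : Fin n → Fin n → Prop) (hT : POI T) :
    pul α T hT ∈ Mset n := by
  constructor
  · rintro a b c (h | ⟨a', b', h1, h2, h3⟩) (h' | ⟨a'', c', h4, h5, h6⟩)
    · exact Or.inl h
    · exact Or.inl h
    · exact Or.inr (Or.inl h')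
    · have := GR.fn hT h1 h4
      subst this
      rcases hα.1 _ _ _ h3 h6 with h | h | h
      · subst h; exact Or.inl (GR.inj hT h1 h2)
      · subst h; exact Or.inr (Or.inl (GR.inj hT h1 h5))
      · subst h; exact Or.inr (Or.inr (GR.inj hT h2 h5))
  · rintro a b c d (h | ⟨a', b', h1, h2, h3⟩) (h' | ⟨c', d', h4, h5, h6⟩) h7 h8 h9
    · subst h; omega
    · subst h; omega
    · subst h'; omega
    · exact hα.2 _ _ _ _ h3 h6 (GR.vp hT h1 h4 h7) (GR.vp hT h4 h2 h8) (GR.vp hT h2 h5 h9)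

/-- `D` is an openable set of upper points. -/
structure Opb (α : Dgm n) (D : Set (Fin n)) : Prop where
  dom : domSet α ⊆ D
  cl : ∀ u v, α.r (Sum.inl u) (Sum.inl v) → u ∈ D → v ∈ D
  nn : ∀ u v x, α.r (Sum.inl u) (Sum.inl v) → u ∉ D → x ∈ D → u < x → x < v → False

def cnt (D : Set (Fin n)) (u : Fin n) : ℕ := {w | w ∈ D ∧ w < u}.ncard

theorem cnt_lt (D : Set (Fin n)) {u v : Fin n} (hu : u ∈ D) (h : u < v) : cnt D u < cnt D v := by
  apply Set.ncard_lt_ncard _ (Set.toFinite _)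
  refine ⟨fun w hw => ⟨hw.1, hw.2.trans h⟩, fun hh => ?_⟩
  exact lt_irrefl u (hh ⟨hu, h⟩).2

theorem cnt_le (D : Set (Fin n)) {u v : Fin n} (h : u ≤ v) : cnt D u ≤ cnt D v := by
  apply Set.ncard_le_ncard _ (Set.toFinite _)
  exact fun w hw => ⟨hw.1, hw.2.trans_le h⟩

theorem cnt_lt_card (D : Set (Fin n)) {u : Fin n} (hu : u ∈ D) : cnt D u < D.ncard := by
  apply Set.ncard_lt_ncard _ (Set.toFinite _)
  refine ⟨fun w hw => hw.1, fun hh => ?_⟩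
  exact lt_irrefl u (hh hu).2

theorem cnt_le_card (D : Set (Fin n)) (u : Fin n) : cnt D u ≤ D.ncard := by
  apply Set.ncard_le_ncard _ (Set.toFinite _)
  exact fun w hw => hw.1

theorem card_le_n (D : Set (Fin n)) : D.ncard ≤ n := by
  have := Set.ncard_le_ncard (Set.subset_univ D) (Set.toFinite _)
  simpa [Set.ncard_univ] using this

theorem lemA {α : Dgm n} {s r : ℕ} (hα : α ∈ DM n s) (D : Set (Fin n)) (hD : Opb α D)
    (hr : D.ncard = r) : ∃ β ∈ DM n r, ∃ δ ∈ DM n s, α = pmul β δ ∧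
      (∀ i : Fin n, r ≤ i → UpperSingleton δ i) ∧
      (∀ a b, δ.r (Sum.inr a) (Sum.inr b) ↔ α.r (Sum.inr a) (Sum.inr b)) ∧
      codomSet δ = codomSet α := by
  let T : Fin n → Fin n → Prop := fun u i => u ∈ D ∧ (i : ℕ) = cnt D u
  have hT : POI T := by
    rintro u v i j ⟨hu, h1⟩ ⟨hv, h2⟩
    constructor
    · intro h
      have := cnt_lt D hu h
      omega
    · intro h
      by_contra h'
      have := cnt_le D (not_lt.1 h')
      omega
  have hex : ∀ u ∈ D, ∃ i, T u i := fun u hu =>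
    ⟨⟨cnt D u, (cnt_lt_card D hu).trans_le (card_le_n D)⟩, hu, rfl⟩
  have hnT : ∀ u, (∀ i, ¬ T u i) ↔ u ∉ D := by
    intro u
    constructor
    · intro h hu
      obtain ⟨i, hi⟩ := hex u hu
      exact h i hi
    · intro h i hi
      exact h hi.1
  have hcod : ∀ a, (∃ j, (pul α T hT).r (Sum.inr a) (Sum.inl j)) ↔
      ∃ j, α.r (Sum.inr a) (Sum.inl j) := by
    intro a
    constructor
    · rintro ⟨j, h | ⟨a', b', h1, h2, h3⟩⟩
      · cases h
      · rcases a' with a' | a'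
        · exact h1.elim
        rcases b' with b' | b'
        · have h1 : a = a' := h1
          subst h1
          exact ⟨b', h3⟩
        · exact h2.elim
    · rintro ⟨j, h⟩
      obtain ⟨i, hi⟩ := hex j (hD.dom ⟨a, α.iseqv.symm h⟩)
      exact ⟨i, Or.inr ⟨Sum.inr a, Sum.inl j, rfl, hi, h⟩⟩
  have hcod' : codomSet (pul α T hT) = codomSet α := Set.ext hcod
  refine ⟨opn α T hT, ⟨opn_Mset hα.1 T hT ?_, ?_⟩, pul α T hT, ⟨pul_Mset hα.1 T hT, ?_⟩, ?_, ?_,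
    ?_, hcod'⟩
  · intro u v x i h1 h2 h3 h4 h5
    exact hD.nn u v x h1 ((hnT u).1 h2) h3.1 h4 h5
  · rw [← hr]
    unfold prank
    congr 1
    rw [opn_dom]
    ext u
    exact ⟨fun ⟨i, hi⟩ => hi.1, hex u⟩
  · rw [← prank_star (pul_Mset hα.1 T hT).1, ← hα.2, ← prank_star hα.1.1]
    unfold prank
    rw [codom_eq, codom_eq, hcod']
  · apply pmul_eq _ _ _ _ (fun c v => match v with
      | Sum.inl i => α.r c (Sum.inl i)
      | Sum.inr (Sum.inl m) => ∃ u, T u m ∧ α.r c (Sum.inl u)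
      | Sum.inr (Sum.inr j) => α.r c (Sum.inr j))
    · rintro c (a | a) (b | b) h hc
      · rcases h with rfl | ⟨h1, -, -⟩
        · exact hc
        · exact α.iseqv.trans hc h1
      · exact ⟨a, h, hc⟩
      · obtain ⟨u, hu, hc⟩ := hc
        rw [hT.inj hu h] at hc
        exact hc
      · have h : a = b := h
        subst h; exact hc
    · rintro c a b (rfl | ⟨a', b', h1, h2, h3⟩) hc
      · exact hc
      · have hc' : α.r c a' := by
          rcases a with a | a <;> rcases a' with a' | a'
          · obtain ⟨u, hu, hc⟩ := hc
            rw [hT.inj hu h1] at hc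
            exact hc
          · exact h1.elim
          · exact h1.elim
          · have h1 : a = a' := h1
            subst h1; exact hc
        have := α.iseqv.trans hc' h3
        rcases b with b | b <;> rcases b' with b' | b'
        · exact ⟨b', h2, this⟩
        · exact h2.elim
        · exact h2.elim
        · have h2 : b = b' := h2
          subst h2; exact this
    · rintro c (b | b) <;> exact Iff.rfl
    · have e1 : ∀ u i, T u i → RGen (prodEdges (opn α T hT) (pul α T hT))
          (Sum.inl u) (Sum.inr (Sum.inl i)) := fun u i h =>
        RGen.rel (Or.inl ⟨Sum.inl u, Sum.inr i, h, rfl, rfl⟩)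
      have e2 : ∀ a b, (pul α T hT).r a b → RGen (prodEdges (opn α T hT) (pul α T hT))
          (midBot a) (midBot b) := fun a b h =>
        RGen.rel (Or.inr ⟨a, b, h, rfl, rfl⟩)
      rintro (a | a) (b | b) h
      · by_cases ha : a ∈ D
        · have hb := hD.cl a b h ha
          obtain ⟨i, hi⟩ := hex a ha
          obtain ⟨j, hj⟩ := hex b hb
          exact ((e1 a i hi).trans (e2 (Sum.inl i) (Sum.inl j)
            (Or.inr ⟨Sum.inl a, Sum.inl b, hi, hj, h⟩))).trans (e1 b j hj).symm
        · have hb : b ∉ D := fun hb => ha (hD.cl b a (α.iseqv.symm h) hb)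
          exact RGen.rel (Or.inl ⟨Sum.inl a, Sum.inl b,
            Or.inr ⟨h, (hnT a).2 ha, (hnT b).2 hb⟩, rfl, rfl⟩)
      · obtain ⟨i, hi⟩ := hex a (hD.dom ⟨b, h⟩)
        exact (e1 a i hi).trans (e2 (Sum.inl i) (Sum.inr b) (Or.inr ⟨Sum.inl a, Sum.inr b, hi, rfl, h⟩))
      · obtain ⟨i, hi⟩ := hex b (hD.dom ⟨a, α.iseqv.symm h⟩)
        exact ((e1 b i hi).trans (e2 (Sum.inl i) (Sum.inr a)
          (Or.inr ⟨Sum.inl b, Sum.inr a, hi, rfl, α.iseqv.symm h⟩))).symm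
      · exact e2 (Sum.inr a) (Sum.inr b) (Or.inr ⟨Sum.inr a, Sum.inr b, rfl, rfl, h⟩)
  · rintro i hi y (h | ⟨a', b', h1, h2, h3⟩)
    · exact h.symm
    · rcases a' with a' | a'
      · have h1 : T a' i := h1
        have := cnt_lt_card D h1.1
        have h5 := h1.2
        omega
      · exact h1.elim
  · intro a b
    constructor
    · rintro (h | ⟨a', b', h1, h2, h3⟩)
      · cases h; exact α.iseqv.refl _
      · rcases a' with a' | a'
        · exact h1.elim
        rcases b' with b' | b'
        · exact h2.elim
        have h1 : a = a' := h1
        have h2 : b = b' := h2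
        subst h1 h2
        exact h3
    · intro h
      exact Or.inr ⟨Sum.inr a, Sum.inr b, rfl, rfl, h⟩

theorem lemA2 {α : Dgm n} {s r : ℕ} (hα : α ∈ DM n s) (D D' : Set (Fin n)) (hD : Opb α D)
    (hD' : Opb (pstar α) D') (hr : D.ncard = r) (hr' : D'.ncard = r) :
    ∃ β₁ ∈ DM n r, ∃ β₂ ∈ DM n r, ∃ δ ∈ DM n s, α = pmul β₁ (pmul δ β₂) ∧
      (∀ i : Fin n, r ≤ i → UpperSingleton δ i) ∧
      (∀ i : Fin n, r ≤ i → LowerSingleton δ i) := by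
  obtain ⟨β₁, hβ₁, δ₁, hδ₁, e1, h1, h2, h3⟩ := lemA hα D hD hr
  have hD1 : Opb (pstar δ₁) D' := by
    refine ⟨?_, ?_, ?_⟩
    · have := hD'.dom
      rw [codom_eq] at this ⊢
      rwa [h3]
    · intro u v h
      exact hD'.cl u v ((h2 u v).1 h)
    · intro u v x h
      exact hD'.nn u v x ((h2 u v).1 h)
  obtain ⟨β₂, hβ₂, δ₂, hδ₂, e2, h4, h5, h6⟩ := lemA (DM_star hδ₁) D' hD1 hr'
  refine ⟨β₁, hβ₁, pstar β₂, DM_star hβ₂, pstar δ₂, DM_star hδ₂, ?_, ?_, ?_⟩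
  · rw [← pstar_pmul, ← e2, pstar_pstar]; exact e1
  · intro i hi
    rw [US_star]
    have := (LS_star δ₁ i).2 (h1 i hi)
    rintro (y | y) hy
    · exfalso
      have : i ∈ codomSet δ₂ := ⟨y, hy⟩
      rw [h6] at this
      obtain ⟨j, hj⟩ := this
      have := (LS_star δ₁ i).2 (h1 i hi) _ hj
      cases this
    · exact this _ ((h5 i y).1 hy)
  · intro i hi
    rw [LS_star]
    exact h4 i hi

/-! ### Two-factor decomposition -/

theorem lem2 {α : Dgm n} {s : ℕ} (hα : α ∈ DM n s) (hs : s + 2 ≤ n) (x y : Fin n)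
    (hx : UpperSingleton α x) (hxn : ¬ UpperNested α x)
    (hy : LowerSingleton α y) (hyn : ¬ LowerNested α y) :
    ∃ β ∈ DM n (s + 1), ∃ γ ∈ DM n (s + 1), α = pmul β γ ∧
      (∀ z, z ≠ x → UpperSingleton α z → ¬ UpperNested α z →
        UpperSingleton β z ∧ ¬ UpperNested β z) ∧
      (∃ z, LowerSingleton β z ∧ ¬ LowerNested β z) ∧
      (∀ z, z ≠ y → LowerSingleton α z → ¬ LowerNested α z →
        LowerSingleton γ z ∧ ¬ LowerNested γ z) ∧
      (∃ z, UpperSingleton γ z ∧ ¬ UpperNested γ z) := by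
  have hM := hα.1
  have hcard : (domSet α).ncard = s := hα.2
  let c := cnt (domSet α)
  let i := c x
  let J : Set (Fin n) := {w | ∃ v, α.r (Sum.inl w) (Sum.inr v) ∧ v < y}
  let j := J.ncard
  have hJs : j ≤ s := by
    rw [← hcard]
    apply Set.ncard_le_ncard _ (Set.toFinite _)
    rintro w ⟨v, h, -⟩
    exact ⟨v, h⟩
  have his : i ≤ s := by rw [← hcard]; exact cnt_le_card _ _
  have hJlt : ∀ u v, α.r (Sum.inl u) (Sum.inr v) → v < y → c u < j := by
    intro u v h1 h2
    apply Set.ncard_lt_ncard _ (Set.toFinite _)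
    refine ⟨?_, fun hh => ?_⟩
    · rintro w ⟨⟨v', h3⟩, h4⟩
      exact ⟨v', h3, ((trans_mono hM h3 h1).1 h4).trans h2⟩
    · exact lt_irrefl u (hh ⟨v, h1, h2⟩).2
  have hJge : ∀ u v, α.r (Sum.inl u) (Sum.inr v) → y < v → j ≤ c u := by
    intro u v h1 h2
    apply Set.ncard_le_ncard _ (Set.toFinite _)
    rintro w ⟨v', h3, h4⟩
    exact ⟨⟨v', h3⟩, (trans_mono hM h3 h1).2 (h4.trans h2)⟩
  have hxd : ∀ v, ¬ α.r (Sum.inl x) (Sum.inr v) := fun v h => by cases hx _ h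
  have hyd : ∀ u, ¬ α.r (Sum.inl u) (Sum.inr y) := fun v h => by cases hy _ (α.iseqv.symm h)
  have hclt : ∀ u w v, α.r (Sum.inl u) (Sum.inr v) → u < w → c u < c w := fun u w v h h' =>
    cnt_lt _ ⟨v, h⟩ h'
  have hcs : ∀ u v, α.r (Sum.inl u) (Sum.inr v) → c u < s := fun u v h => by
    rw [← hcard]; exact cnt_lt_card _ ⟨v, h⟩
  have hcle : ∀ u w, u ≤ w → c u ≤ c w := fun u w h => cnt_le _ h
  let F : ℕ → ℕ := fun t => t + (if i ≤ t then 1 else 0) + (if j ≤ t then 1 else 0)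
  let e : ℕ := i + (if j < i then 1 else 0)
  let f : ℕ := j + (if i ≤ j then 1 else 0)
  have hFlt : ∀ t t', t < t' → F t < F t' := by
    intro t t' h
    simp only [F]
    split_ifs <;> omega
  have hFinj : ∀ t t', F t = F t' → t = t' := by
    intro t t' h
    rcases lt_trichotomy t t' with h1 | h1 | h1
    · have := hFlt _ _ h1; omega
    · exact h1
    · have := hFlt _ _ h1; omega
  have hFe : ∀ t, t < i → F t < e := by
    intro t h; simp only [F, e]; split_ifs <;> omega
  have hFe' : ∀ t, i ≤ t → e < F t := by
    intro t h; simp only [F, e]; split_ifs <;> omega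
  have hFf : ∀ t, t < j → F t < f := by
    intro t h; simp only [F, f]; split_ifs <;> omega
  have hFf' : ∀ t, j ≤ t → f < F t := by
    intro t h; simp only [F, f]; split_ifs <;> omega
  have hef : e ≠ f := by simp only [e, f]; split_ifs <;> omega
  have hen : e < n := by simp only [e]; split_ifs <;> omega
  have hfn : f < n := by simp only [f]; split_ifs <;> omega
  have hFn : ∀ t, t < s → F t < n := by
    intro t h; simp only [F]; split_ifs <;> omega
  clear_value F e f j
  let T₁ : Fin n → Fin n → Prop := fun u m =>
    (∃ v, α.r (Sum.inl u) (Sum.inr v) ∧ (m : ℕ) = F (c u)) ∨ (u = x ∧ (m : ℕ) = e)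
  let T₂ : Fin n → Fin n → Prop := fun v m =>
    (∃ u, α.r (Sum.inl u) (Sum.inr v) ∧ (m : ℕ) = F (c u)) ∨ (v = y ∧ (m : ℕ) = f)
  have poi : ∀ T : Fin n → Fin n → Prop, (∀ u v k l, T u k → T v l → u < v → k < l) →
      (∀ u k l, T u k → T u l → k = l) → POI T := by
    intro T h1 h2 u v k l h3 h4
    refine ⟨h1 _ _ _ _ h3 h4, fun h => ?_⟩
    rcases lt_trichotomy u v with h5 | h5 | h5
    · exact h5
    · subst h5; have := h2 _ _ _ h3 h4; omega
    · have := h1 _ _ _ _ h4 h3 h5; omega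
  have hT₁ : POI T₁ := by
    apply poi
    · rintro u v k l (⟨a, h1, h2⟩ | ⟨rfl, h2⟩) (⟨b, h3, h4⟩ | ⟨rfl, h4⟩) h
      · have := hFlt _ _ (hclt u v a h1 h); omega
      · have := hFe _ (hclt u v a h1 h); omega
      · have := hFe' _ (hcle u v h.le); omega
      · omega
    · rintro u k l (⟨a, h1, h2⟩ | ⟨rfl, h2⟩) (⟨b, h3, h4⟩ | ⟨h3, h4⟩)
      · omega
      · subst h3; exact (hxd _ h1).elim
      · exact (hxd _ h3).elim
      · omega
  have hT₂ : POI T₂ := by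
    apply poi
    · rintro u v k l (⟨a, h1, h2⟩ | ⟨rfl, h2⟩) (⟨b, h3, h4⟩ | ⟨rfl, h4⟩) h
      · have := hFlt _ _ (hclt a b u h1 ((trans_mono hM h1 h3).2 h)); omega
      · have := hFf _ (hJlt a u h1 h); omega
      · have := hFf' _ (hJge b v h3 h); omega
      · omega
    · rintro u k l (⟨a, h1, h2⟩ | ⟨rfl, h2⟩) (⟨b, h3, h4⟩ | ⟨h3, h4⟩)
      · have := lr_inj hM.1 h1 h3; subst this; omega
      · subst h3; exact (hyd _ h1).elim
      · exact (hyd _ h3).elim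
      · omega
  have hM' := Mset_star hM
  have hcard' : (codomSet α).ncard = s := (DM_star hα).2
  have hβ : opn α T₁ hT₁ ∈ DM n (s + 1) := by
    refine ⟨opn_Mset hM T₁ hT₁ ?_, ?_⟩
    · rintro u v w k h1 - (⟨a, h2, -⟩ | ⟨rfl, -⟩) h3 h4
      · exact hook_trans hM.2 h1 h2 h3 h4
      · exact hxn ⟨u, v, h1, h3, h4⟩
    · unfold prank
      rw [opn_dom]
      have : {u | ∃ i, T₁ u i} = insert x (domSet α) := by
        ext u
        constructor
        · rintro ⟨k, ⟨v, h, -⟩ | ⟨h, -⟩⟩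
          · exact Or.inr ⟨v, h⟩
          · exact Or.inl h
        · rintro (h | ⟨v, h⟩)
          · exact ⟨⟨e, hen⟩, Or.inr ⟨h, rfl⟩⟩
          · exact ⟨⟨F (c u), hFn _ (hcs u v h)⟩, Or.inl ⟨v, h, rfl⟩⟩
      rw [this, Set.ncard_insert_of_notMem (show x ∉ domSet α from fun ⟨v, h⟩ => hxd v h) (Set.toFinite _), hcard]
  have hγ : opn (pstar α) T₂ hT₂ ∈ DM n (s + 1) := by
    refine ⟨opn_Mset hM' T₂ hT₂ ?_, ?_⟩
    · rintro u v w k h1 - (⟨a, h2, -⟩ | ⟨rfl, -⟩) h3 h4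
      · exact hook_trans hM'.2 h1 (α.iseqv.symm h2 : (pstar α).r (Sum.inl w) (Sum.inr a)) h3 h4
      · exact hyn ⟨u, v, h1, h3, h4⟩
    · unfold prank
      rw [opn_dom]
      have : {u | ∃ i, T₂ u i} = insert y (codomSet α) := by
        ext u
        constructor
        · rintro ⟨k, ⟨v, h, -⟩ | ⟨h, -⟩⟩
          · exact Or.inr ⟨v, α.iseqv.symm h⟩
          · exact Or.inl h
        · rintro (h | ⟨v, h⟩)
          · exact ⟨⟨f, hfn⟩, Or.inr ⟨h, rfl⟩⟩
          · have h := α.iseqv.symm h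
            exact ⟨⟨F (c v), hFn _ (hcs v u h)⟩, Or.inl ⟨v, h, rfl⟩⟩
      rw [this, Set.ncard_insert_of_notMem (show y ∉ codomSet α from fun ⟨v, h⟩ => hyd v (α.iseqv.symm h))
        (Set.toFinite _), hcard']
  have hcomp : ∀ u v m, T₁ u m → T₂ v m → α.r (Sum.inl u) (Sum.inr v) := by
    rintro u v m (⟨a, h1, h2⟩ | ⟨rfl, h2⟩) (⟨b, h3, h4⟩ | ⟨rfl, h4⟩)
    · have h5 : c u = c b := hFinj _ _ (by omega)
      have : u = b := by
        rcases lt_trichotomy u b with h | h | h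
        · have := hclt u b a h1 h; omega
        · exact h
        · have := hclt b u v h3 h; omega
      subst this; exact h3
    · rcases lt_or_ge (c u) j with h | h
      · have := hFf _ h; omega
      · have := hFf' _ h; omega
    · rcases lt_or_ge (c b) (c u) with h | h
      · have := hFe _ h; omega
      · have := hFe' _ h; omega
    · omega
  have hns : ∀ (α : Dgm n) (T : Fin n → Fin n → Prop) (hT : POI T) (m : Fin n),
      (∀ u, ¬ T u m) → LowerSingleton (opn α T hT) m ∧ ¬ LowerNested (opn α T hT) m := by
    intro α T hT m h
    constructor
    · rintro (u | u) hu
      · exact (h u hu).elim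
      · exact congrArg Sum.inr (Eq.symm hu)
    · rintro ⟨u, v, h1, h2, h3⟩
      have h1 : u = v := h1
      omega
  refine ⟨opn α T₁ hT₁, hβ, pstar (opn (pstar α) T₂ hT₂), DM_star hγ, ?_, ?_, ?_, ?_, ?_⟩
  · apply pmul_eq _ _ _ _ (fun c v => match v with
      | Sum.inl i => α.r c (Sum.inl i)
      | Sum.inr (Sum.inl m) => (∃ u, T₁ u m ∧ α.r c (Sum.inl u)) ∨
          (∃ u, T₂ u m ∧ α.r c (Sum.inr u))
      | Sum.inr (Sum.inr j) => α.r c (Sum.inr j))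
    · rintro c (a | a) (b | b) h hc
      · rcases h with rfl | ⟨h1, -, -⟩
        · exact hc
        · exact α.iseqv.trans hc h1
      · exact Or.inl ⟨a, h, hc⟩
      · rcases hc with ⟨u, hu, hc⟩ | ⟨u, hu, hc⟩
        · rw [hT₁.inj hu h] at hc
          exact hc
        · exact α.iseqv.trans hc (α.iseqv.symm (hcomp b u a h hu))
      · have h : a = b := h
        subst h; exact hc
    · rintro c (a | a) (b | b) h hc
      · have h : a = b := h
        subst h; exact hc
      · rcases hc with ⟨u, hu, hc⟩ | ⟨u, hu, hc⟩
        · exact α.iseqv.trans hc (hcomp u b a hu h)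
        · rw [hT₂.inj hu h] at hc
          exact hc
      · exact Or.inr ⟨a, h, hc⟩
      · rcases h with h | ⟨h1, -, -⟩
        · subst h; exact hc
        · exact α.iseqv.trans hc h1
    · rintro c (b | b) <;> exact Iff.rfl
    · have ndT : ∀ u v, α.r (Sum.inl u) (Sum.inl v) → u ≠ v → ∀ i, ¬ T₁ u i := by
        rintro u v h h' i (⟨a, h1, -⟩ | ⟨rfl, -⟩)
        · exact h' (ll_lr hM.1 h h1)
        · exact h' (Sum.inl.inj (hx _ h)).symm
      have ndT2 : ∀ u v, α.r (Sum.inr u) (Sum.inr v) → u ≠ v → ∀ i, ¬ T₂ u i := by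
        rintro u v h h' i (⟨a, h1, -⟩ | ⟨rfl, -⟩)
        · exact h' (ll_lr hM'.1 (h : (pstar α).r (Sum.inl u) (Sum.inl v))
            (α.iseqv.symm h1 : (pstar α).r (Sum.inl u) (Sum.inr a)))
        · exact h' (Sum.inr.inj (hy _ h)).symm
      have e1 : ∀ u i, T₁ u i → RGen (prodEdges (opn α T₁ hT₁) (pstar (opn (pstar α) T₂ hT₂)))
          (Sum.inl u) (Sum.inr (Sum.inl i)) := fun u i h =>
        RGen.rel (Or.inl ⟨Sum.inl u, Sum.inr i, h, rfl, rfl⟩)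
      have e2 : ∀ u i, T₂ u i → RGen (prodEdges (opn α T₁ hT₁) (pstar (opn (pstar α) T₂ hT₂)))
          (Sum.inr (Sum.inl i)) (Sum.inr (Sum.inr u)) := fun u i h =>
        RGen.rel (Or.inr ⟨Sum.inl i, Sum.inr u, h, rfl, rfl⟩)
      have e3 : ∀ u v, α.r (Sum.inl u) (Sum.inr v) →
          RGen (prodEdges (opn α T₁ hT₁) (pstar (opn (pstar α) T₂ hT₂)))
          (Sum.inl u) (Sum.inr (Sum.inr v)) := fun u v h =>
        (e1 u ⟨F (c u), hFn _ (hcs u v h)⟩ (Or.inl ⟨v, h, rfl⟩)).trans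
          (e2 v ⟨F (c u), hFn _ (hcs u v h)⟩ (Or.inl ⟨u, h, rfl⟩))
      rintro (a | a) (b | b) h
      · by_cases hab : a = b
        · subst hab; exact RGen.refl _
        · exact RGen.rel (Or.inl ⟨Sum.inl a, Sum.inl b,
            Or.inr ⟨h, ndT a b h hab, ndT b a (α.iseqv.symm h) (Ne.symm hab)⟩, rfl, rfl⟩)
      · exact e3 a b h
      · exact (e3 b a (α.iseqv.symm h)).symm
      · by_cases hab : a = b
        · subst hab; exact RGen.refl _
        · exact RGen.rel (Or.inr ⟨Sum.inr a, Sum.inr b,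
            Or.inr ⟨h, ndT2 a b h hab, ndT2 b a (α.iseqv.symm h) (Ne.symm hab)⟩, rfl, rfl⟩)
  · intro z hz h1 h2
    constructor
    · rintro (u | u) hu
      · rcases hu with h | ⟨h, -, -⟩
        · rw [h]
        · exact h1 _ h
      · rcases hu with ⟨v, h, -⟩ | ⟨h, -⟩
        · cases h1 _ h
        · exact (hz h).elim
    · rintro ⟨u, v, h3, h4, h5⟩
      rcases h3 with h3 | ⟨h3, -, -⟩
      · omega
      · exact h2 ⟨u, v, h3, h4, h5⟩
  · refine ⟨⟨f, hfn⟩, hns _ _ _ _ ?_⟩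
    rintro u (⟨v, h, h'⟩ | ⟨h, h'⟩)
    · have h' : f = F (c u) := h'
      rcases lt_or_ge (c u) j with h | h
      · have := hFf _ h; omega
      · have := hFf' _ h; omega
    · exact hef h'.symm
  · intro z hz h1 h2
    constructor
    · rw [LS_star]
      rintro (u | u) hu
      · rcases hu with h | ⟨h, -, -⟩
        · rw [h]
        · exact congrArg Sum.inl (Sum.inr.inj (h1 _ h))
      · rcases hu with ⟨v, h, -⟩ | ⟨h, -⟩
        · cases h1 _ (α.iseqv.symm h)
        · exact (hz h).elim
    · rintro ⟨u, v, h3, h4, h5⟩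
      rcases h3 with h3 | ⟨h3, -, -⟩
      · omega
      · exact h2 ⟨u, v, h3, h4, h5⟩
  · have := hns (pstar α) T₂ hT₂ ⟨e, hen⟩ ?_
    · refine ⟨⟨e, hen⟩, (US_star _ _).2 this.1, this.2⟩
    rintro u (⟨v, h, h'⟩ | ⟨h, h'⟩)
    · have h' : e = F (c v) := h'
      rcases lt_or_ge (c v) i with h | h
      · have := hFe _ h; omega
      · have := hFe' _ h; omega
    · exact hef h'

/-! ### Openable sets -/

theorem exists_notMem (D : Set (Fin n)) (h : D.ncard < n) : ∃ x, x ∉ D := by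
  by_contra hh
  push Not at hh
  have : D = Set.univ := Set.eq_univ_of_forall hh
  rw [this, Set.ncard_univ] at h
  simp at h

theorem opb_dom {α : Dgm n} (hα : α ∈ Mset n) : Opb α (domSet α) := by
  refine ⟨subset_rfl, ?_, ?_⟩
  · rintro u v h ⟨j, hj⟩
    rw [← ll_lr hα.1 h hj]
    exact ⟨j, hj⟩
  · rintro u v x h - ⟨j, hj⟩ h1 h2
    exact hook_trans hα.2 h hj h1 h2

theorem opb_grow {α : Dgm n} (hα : α ∈ Mset n) (D : Set (Fin n)) (hD : Opb α D)
    (hc : D.ncard + 2 ≤ n) : ∃ D', Opb α D' ∧ D'.ncard = D.ncard + 2 := by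
  by_cases hS : ({u | u ∉ D ∧ ∃ v, u < v ∧ α.r (Sum.inl u) (Sum.inl v)} : Set (Fin n)).Nonempty
  · obtain ⟨u, ⟨hu, v, huv, h⟩, hmin⟩ := wellFounded_lt.has_min _ hS
    have hv : v ∉ D := fun hv => hu (hD.cl v u (α.iseqv.symm h) hv)
    refine ⟨insert u (insert v D), ⟨?_, ?_, ?_⟩, ?_⟩
    · exact hD.dom.trans (by intro a ha; simp [ha])
    · rintro a b hab (rfl | rfl | ha)
      · rcases ll_ll hα.1 h hab with h1 | h1 | h1
        · omega
        · simp [h1]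
        · simp [h1]
      · rcases ll_ll hα.1 (α.iseqv.symm h) hab with h1 | h1 | h1
        · omega
        · simp [h1]
        · simp [h1]
      · simp [hD.cl a b hab ha]
    · intro a b x hab ha hx h1 h2
      have ha1 : a ≠ u := fun e => ha (by simp [e])
      have ha3 : a ∉ D := fun e => ha (by simp [e])
      have hm : ¬ a < u := hmin a ⟨ha3, b, h1.trans h2, hab⟩
      rcases hx with rfl | rfl | hx
      · exact hm h1
      · exact hook_hook hα.2 h hab (by omega) h1 h2
      · exact hD.nn a b x hab ha3 hx h1 h2
    · rw [Set.ncard_insert_of_notMem _ (Set.toFinite _),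
        Set.ncard_insert_of_notMem hv (Set.toFinite _)]
      rintro (h1 | h1)
      · omega
      · exact hu h1
  · have hno : ∀ u v, u ∉ D → u < v → ¬ α.r (Sum.inl u) (Sum.inl v) := by
      intro u v h1 h2 h3
      exact hS ⟨u, h1, v, h2, h3⟩
    obtain ⟨x, hx⟩ := exists_notMem D (by omega)
    have hcx : (insert x D).ncard = D.ncard + 1 := Set.ncard_insert_of_notMem hx (Set.toFinite _)
    obtain ⟨y, hy⟩ := exists_notMem (insert x D) (by omega)
    have hself : ∀ u v, u ∉ D → α.r (Sum.inl u) (Sum.inl v) → u = v := by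
      intro u v hu h
      rcases lt_trichotomy u v with h1 | h1 | h1
      · exact (hno u v hu h1 h).elim
      · exact h1
      · exact (hno v u (fun hv => hu (hD.cl v u (α.iseqv.symm h) hv)) h1 (α.iseqv.symm h)).elim
    refine ⟨insert y (insert x D), ⟨?_, ?_, ?_⟩, ?_⟩
    · exact hD.dom.trans (by intro a ha; simp [ha])
    · intro a b hab ha
      by_cases haD : a ∈ D
      · simp [hD.cl a b hab haD]
      · rwa [← hself a b haD hab]
    · intro a b z hab ha hz h1 h2
      have ha3 : a ∉ D := fun e => ha (by simp [e])
      exact hno a b ha3 (h1.trans h2) hab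
    · rw [Set.ncard_insert_of_notMem hy (Set.toFinite _), hcx]

theorem opb_grow' {α : Dgm n} (hα : α ∈ Mset n) (D : Set (Fin n)) (hD : Opb α D) (k : ℕ)
    (hc : D.ncard + 2 * k ≤ n) : ∃ D', Opb α D' ∧ D'.ncard = D.ncard + 2 * k := by
  induction k with
  | zero => exact ⟨D, hD, rfl⟩
  | succ k ih =>
    obtain ⟨D', h1, h2⟩ := ih (by omega)
    obtain ⟨D'', h3, h4⟩ := opb_grow hα D' h1 (by omega)
    exact ⟨D'', h3, by omega⟩

theorem opb_exists {α : Dgm n} {s k : ℕ} (hα : α ∈ DM n s) (x : Fin n) (hx : UpperSingleton α x)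
    (hd : ∀ d, UpperHookChain α x d → d ≤ k) (hn : s + 2 * k + 1 ≤ n) :
    ∃ D, Opb α D ∧ D.ncard = s + 2 * k + 1 := by
  have hM := hα.1
  have hxx : ∀ b, α.r (Sum.inl x) (Sum.inl b) → b = x := fun b h => Sum.inl.inj (hx _ h)
  let A : Set (Fin n) := {u | u < x ∧ ∃ v, x < v ∧ α.r (Sum.inl u) (Sum.inl v)}
  let B : Set (Fin n) := {v | x < v ∧ ∃ u, u < x ∧ α.r (Sum.inl u) (Sum.inl v)}
  have hAB : A.ncard = B.ncard := by
    refine Set.ncard_congr (fun u hu => Classical.choose hu.2) ?_ ?_ ?_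
    · intro u hu
      have h1 := Classical.choose_spec hu.2
      exact ⟨h1.1, u, hu.1, h1.2⟩
    · intro u v hu hv huv
      have h1 := Classical.choose_spec hu.2
      have h2 := Classical.choose_spec hv.2
      have huv : Classical.choose hu.2 = Classical.choose hv.2 := huv
      rw [← huv] at h2
      have := hu.1
      have := hv.1
      rcases ll_ll hM.1 (α.iseqv.symm h1.2) (α.iseqv.symm h2.2) with h | h | h
      · omega
      · omega
      · exact h
    · rintro v ⟨hv, u, hu, h⟩
      have hA : u ∈ A := ⟨hu, v, hv, h⟩
      refine ⟨u, hA, ?_⟩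
      have h1 := Classical.choose_spec hA.2
      rcases ll_ll hM.1 h1.2 h with h | h | h
      · omega
      · omega
      · exact h
  have hAk : A.ncard ≤ k := by
    apply hd
    have hcd : A.toFinset.card = A.ncard := (Set.ncard_eq_toFinset_card' A).symm
    let em := A.toFinset.orderEmbOfFin hcd
    have hem : ∀ i, em i ∈ A := fun i => by
      have := Finset.orderEmbOfFin_mem A.toFinset hcd i
      rwa [Set.mem_toFinset] at this
    let v : Fin A.ncard → Fin n := fun i => Classical.choose (hem i).2
    have hv : ∀ i, x < v i ∧ α.r (Sum.inl (em i)) (Sum.inl (v i)) := fun i =>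
      Classical.choose_spec (hem i).2
    refine ⟨fun i => em (Fin.rev i), fun i => v (Fin.rev i), fun i => (hv _).2,
      fun i => ⟨(hem _).1, (hv _).1⟩, ?_, ?_⟩
    · intro i j hij
      exact em.strictMono (Fin.rev_lt_rev.2 hij)
    · intro i j hij
      have h1 : em (Fin.rev j) < em (Fin.rev i) := em.strictMono (Fin.rev_lt_rev.2 hij)
      have hi := hv (Fin.rev i)
      have hj := hv (Fin.rev j)
      have hi' := (hem (Fin.rev i)).1
      have hj' := (hem (Fin.rev j)).1
      show v (Fin.rev i) < v (Fin.rev j)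
      rcases lt_trichotomy (v (Fin.rev i)) (v (Fin.rev j)) with h | h | h
      · exact h
      · rw [h] at hi
        rcases ll_ll hM.1 (α.iseqv.symm hi.2) (α.iseqv.symm hj.2) with h | h | h <;> omega
      · exact (hook_hook hM.2 hj.2 hi.2 h1 (by omega) h).elim
  have hdA : Disjoint A B := by
    rw [Set.disjoint_left]
    rintro a ⟨h1, -⟩ ⟨h2, -⟩
    omega
  have hdD : Disjoint (domSet α) (A ∪ B) := by
    rw [Set.disjoint_left]
    rintro a ⟨j, hj⟩ (⟨h1, v, h2, h3⟩ | ⟨h1, v, h2, h3⟩)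
    · have := ll_lr hM.1 h3 hj; omega
    · have := ll_lr hM.1 (α.iseqv.symm h3) hj; omega
  have hxD : x ∉ domSet α ∪ (A ∪ B) := by
    rintro (⟨j, hj⟩ | ⟨h1, -⟩ | ⟨h1, -⟩)
    · cases hx _ hj
    · omega
    · omega
  have hcard : (insert x (domSet α ∪ (A ∪ B))).ncard = s + 2 * A.ncard + 1 := by
    rw [Set.ncard_insert_of_notMem hxD (Set.toFinite _),
      Set.ncard_union_eq hdD (Set.toFinite _) (Set.toFinite _),
      Set.ncard_union_eq hdA (Set.toFinite _) (Set.toFinite _), ← hAB]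
    have : (domSet α).ncard = s := hα.2
    omega
  have hop : Opb α (insert x (domSet α ∪ (A ∪ B))) := by
    refine ⟨fun a ha => Or.inr (Or.inl ha), ?_, ?_⟩
    · rintro a b hab (rfl | ⟨j, hj⟩ | ⟨h1, v, h2, h3⟩ | ⟨h1, v, h2, h3⟩)
      · exact Or.inl (hxx b hab)
      · rw [← ll_lr hM.1 hab hj]; exact Or.inr (Or.inl ⟨j, hj⟩)
      · rcases ll_ll hM.1 h3 hab with h | h | h
        · omega
        · subst h; exact Or.inr (Or.inr (Or.inl ⟨h1, v, h2, h3⟩))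
        · subst h; exact Or.inr (Or.inr (Or.inr ⟨h2, a, h1, h3⟩))
      · rcases ll_ll hM.1 (α.iseqv.symm h3) hab with h | h | h
        · omega
        · subst h; exact Or.inr (Or.inr (Or.inr ⟨h1, v, h2, h3⟩))
        · subst h; exact Or.inr (Or.inr (Or.inl ⟨h2, a, h1, α.iseqv.symm hab⟩))
    · intro a b w hab ha hw h1 h2
      have hax : a ≠ x := fun e => ha (Or.inl e)
      have hbx : b ≠ x := fun e => by
        subst e
        exact hax (hxx a (α.iseqv.symm hab))
      have haA : ¬ (a < x ∧ x < b) := fun e => ha (Or.inr (Or.inr (Or.inl ⟨e.1, b, e.2, hab⟩)))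
      rcases hw with rfl | ⟨j, hj⟩ | ⟨h3, v, h4, h5⟩ | ⟨h3, v, h4, h5⟩
      · exact haA ⟨h1, h2⟩
      · exact hook_trans hM.2 hab hj h1 h2
      · exact hook_hook hM.2 hab h5 h1 h2 (by omega)
      · exact hook_hook hM.2 h5 hab (by omega) h1 h2
  obtain ⟨D', h1, h2⟩ := opb_grow' hM _ hop (k - A.ncard) (by omega)
  exact ⟨D', h1, by omega⟩

/-! ### Parity-preserving descent -/

theorem last_unnested {δ : Dgm n} {r : ℕ} (h1 : ∀ i : Fin n, r ≤ i → UpperSingleton δ i)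
    (i : Fin n) (hi : r ≤ i) : ¬ UpperNested δ i := by
  rintro ⟨u, v, h2, h3, h4⟩
  have := h1 v (by omega) _ (δ.iseqv.symm h2)
  have := Sum.inl.inj this
  omega

theorem last_unnested' {δ : Dgm n} {r : ℕ} (h1 : ∀ i : Fin n, r ≤ i → LowerSingleton δ i)
    (i : Fin n) (hi : r ≤ i) : ¬ LowerNested δ i := by
  rintro ⟨u, v, h2, h3, h4⟩
  have := h1 v (by omega) _ (δ.iseqv.symm h2)
  have := Sum.inr.inj this
  omega

theorem lem3 {s : ℕ} (hs : s + 4 ≤ n) : DM n s ⊆ genSet (pmul (n := n)) (DM n (s + 2)) := by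
  intro α hα
  obtain ⟨D, hD, hc⟩ := opb_grow hα.1 _ (opb_dom hα.1) (by
    have : (domSet α).ncard = s := hα.2
    omega)
  have hα' := DM_star hα
  obtain ⟨D', hD', hc'⟩ := opb_grow hα'.1 _ (opb_dom hα'.1) (by
    have : (domSet (pstar α)).ncard = s := hα'.2
    omega)
  have e1 : (domSet α).ncard = s := hα.2
  have e2 : (domSet (pstar α)).ncard = s := hα'.2
  rw [e1] at hc
  rw [e2] at hc'
  obtain ⟨β₁, hβ₁, β₂, hβ₂, δ, hδ, e, hU, hL⟩ := lemA2 hα D D' hD hD' hc hc'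
  rw [e]
  refine MClo.mul (MClo.base hβ₁) (MClo.mul ?_ (MClo.base hβ₂))
  let p : Fin n := ⟨n - 1, by omega⟩
  let q : Fin n := ⟨n - 2, by omega⟩
  have hp : s + 2 ≤ (p : ℕ) := by simp only [p]; omega
  have hq : s + 2 ≤ (q : ℕ) := by simp only [q]; omega
  have hqp : q ≠ p := by
    intro h
    have := congrArg Fin.val h
    simp only [p, q] at this
    omega
  obtain ⟨β, hβ, γ, hγ, e', h1, ⟨z, hz, hz'⟩, h2, ⟨w, hw, hw'⟩⟩ := lem2 hδ (by omega) p p (hU p hp)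
    (last_unnested hU p hp) (hL p hp) (last_unnested' hL p hp)
  rw [e']
  obtain ⟨g1, g2⟩ := h1 q hqp (hU q hq) (last_unnested hU q hq)
  obtain ⟨g3, g4⟩ := h2 q hqp (hL q hq) (last_unnested' hL q hq)
  refine MClo.mul ?_ ?_
  · obtain ⟨a, ha, b, hb, e, -⟩ := lem2 hβ (by omega) q z g1 g2 hz hz'
    rw [e]
    exact MClo.mul (MClo.base ha) (MClo.base hb)
  · obtain ⟨a, ha, b, hb, e, -⟩ := lem2 hγ (by omega) w q hw hw' g3 g4
    rw [e]
    exact MClo.mul (MClo.base ha) (MClo.base hb)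

theorem lem3' {s : ℕ} (k : ℕ) (hs : s + 2 * k + 2 ≤ n) :
    DM n s ⊆ genSet (pmul (n := n)) (DM n (s + 2 * k)) := by
  induction k with
  | zero => exact fun α h => MClo.base h
  | succ k ih =>
    intro α h
    exact gen_trans (lem3 (s := s + 2 * k) (by omega)) (ih (by omega) h)

theorem suff {s k : ℕ} (hn : s + 2 * k + 1 + 2 ≤ n) {α : Dgm n} (hα : α ∈ DM n s) (x y : Fin n)
    (hx : UpperSingleton α x) (hxd : ∀ d, UpperHookChain α x d → d ≤ k)
    (hy : LowerSingleton α y) (hyd : ∀ d, LowerHookChain α y d → d ≤ k) :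
    α ∈ genSet (pmul (n := n)) (DM n (s + 2 * k + 1)) := by
  obtain ⟨D, hD, hc⟩ := opb_exists hα x hx hxd (by omega)
  obtain ⟨D', hD', hc'⟩ := opb_exists (DM_star hα) y ((US_star α y).2 hy) hyd (by omega)
  obtain ⟨β₁, hβ₁, β₂, hβ₂, δ, hδ, e, hU, hL⟩ := lemA2 hα D D' hD hD' hc hc'
  rw [e]
  refine MClo.mul (MClo.base hβ₁) (MClo.mul ?_ (MClo.base hβ₂))
  let p : Fin n := ⟨n - 1, by omega⟩
  have hp : s + 2 * k + 1 ≤ (p : ℕ) := by simp only [p]; omega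
  obtain ⟨a, ha, b, hb, e, -⟩ := lem2 hδ (by omega) p p (hU p hp)
    (last_unnested hU p hp) (hL p hp) (last_unnested' hL p hp)
  have h := lem3' (n := n) (s := s + 1) k (by omega)
  rw [show s + 2 * k + 1 = s + 1 + 2 * k by omega, e]
  exact MClo.mul (h ha) (h hb)

/-! ### Necessity -/

theorem nec1 {r : ℕ} {α : Dgm n} (h : α ∈ genSet (pmul (n := n)) (DM n r)) :
    ∃ β ∈ DM n r, (∀ a b, β.r (Sum.inl a) (Sum.inl b) → α.r (Sum.inl a) (Sum.inl b)) ∧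
      ∀ x, UpperSingleton β x → UpperSingleton α x := by
  induction h with
  | base h => exact ⟨_, h, fun _ _ h => h, fun _ h => h⟩
  | @mul α γ _ _ ih1 _ =>
    obtain ⟨β, hβ, h1, h2⟩ := ih1
    refine ⟨β, hβ, fun a b h => ?_, fun x hx => ?_⟩
    · exact RGen.rel (Or.inl ⟨Sum.inl a, Sum.inl b, h1 a b h, rfl, rfl⟩)
    · have hx := h2 x hx
      have key : ∀ v w, RGen (prodEdges α γ) v w → (v = Sum.inl x ↔ w = Sum.inl x) := by
        intro v w h
        induction h with
        | rel h =>
          rcases h with ⟨a, b, h, rfl, rfl⟩ | ⟨a, b, h, rfl, rfl⟩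
          · have e : ∀ c : PBV n, topMid c = Sum.inl x ↔ c = Sum.inl x := by
              rintro (c | c) <;> simp [topMid]
            rw [e, e]
            constructor
            · rintro rfl; exact hx _ h
            · rintro rfl; exact hx _ (α.iseqv.symm h)
          · have e : ∀ c : PBV n, ¬ midBot c = Sum.inl x := by
              rintro (c | c) <;> simp [midBot]
            simp [e]
        | refl => rfl
        | symm _ ih => exact ih.symm
        | trans _ _ ih1 ih2 => exact ih1.trans ih2
      intro y hy
      have := (key _ _ hy).1 rfl
      rcases y with y | y
      · have this : (Sum.inl y : V3 n) = Sum.inl x := this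
        rw [Sum.inl.inj this]
      · cases this

theorem nec2 {r s : ℕ} (hsr : s ≤ r) (hpar : r % 2 ≠ s % 2) {α : Dgm n} (hα : α ∈ DM n s)
    (h : α ∈ genSet (pmul (n := n)) (DM n r)) : ∃ x : Fin n, UpperSingleton α x ∧
          ∀ d : ℕ, UpperHookChain α x d → d ≤ (r - s - 1) / 2 := by
  obtain ⟨β, hβ, h1, h2⟩ := nec1 h
  have hM := hα.1
  have hB := hβ.1
  -- points outside `dom β`
  have hout : ∀ u, u ∉ domSet β → UpperSingleton α u ∨
      ∃ w, w ≠ u ∧ β.r (Sum.inl u) (Sum.inl w) := by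
    intro u hu
    by_contra hh
    push Not at hh
    apply hh.1
    apply h2
    rintro (y | y) hy
    · by_contra hne
      exact hh.2 y (fun e => hne (by rw [e])) hy
    · exact (hu ⟨y, hy⟩).elim
  have hhook : ∀ u v, u ≠ v → α.r (Sum.inl u) (Sum.inl v) → u ∉ domSet β →
      β.r (Sum.inl u) (Sum.inl v) := by
    intro u v hne huv hu
    rcases hout u hu with h | ⟨w, hw, h⟩
    · exact (hne (Sum.inl.inj (h _ huv)).symm).elim
    · rcases ll_ll hM.1 huv (h1 _ _ h) with h' | h' | h'
      · exact (hne h').elim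
      · exact (hw h'.symm).elim
      · rw [h']; exact h
  have hdom : domSet α ⊆ domSet β := by
    rintro u ⟨j, hj⟩
    by_contra hu
    rcases hout u hu with h | ⟨w, hw, h⟩
    · cases h _ hj
    · exact hw (ll_lr hM.1 (h1 _ _ h) hj).symm
  have hnd : ∀ u v, u ≠ v → α.r (Sum.inl u) (Sum.inl v) → u ∉ domSet α := by
    rintro u v hne h ⟨j, hj⟩
    exact hne (ll_lr hM.1 h hj)
  have hScard : (domSet β \ domSet α).ncard = r - s := by
    rw [Set.ncard_sdiff hdom (Set.toFinite _)]
    have e1 : (domSet α).ncard = s := hα.2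
    have e2 : (domSet β).ncard = r := hβ.2
    rw [e1, e2]
  have hex : ∃ x ∈ domSet β \ domSet α, UpperSingleton α x := by
    by_contra hno
    push Not at hno
    have hpart : ∀ x ∈ domSet β \ domSet α, ∃ v ∈ domSet β \ domSet α, v ≠ x ∧
        α.r (Sum.inl x) (Sum.inl v) := by
      intro x hx
      have := hno x hx
      unfold UpperSingleton at this
      push Not at this
      obtain ⟨y, hy, hne⟩ := this
      rcases y with y | y
      · have hne : y ≠ x := fun e => hne (by rw [e])
        refine ⟨y, ⟨?_, hnd y x hne (α.iseqv.symm hy)⟩, hne, hy⟩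
        by_contra hyd
        obtain ⟨j, hj⟩ := hx.1
        exact hne (ll_lr hB.1 (β.iseqv.symm (hhook y x hne (α.iseqv.symm hy) hyd)) hj).symm
      · exact (hx.2 ⟨y, hy⟩).elim
    let A : Set (Fin n) := {u | u ∈ domSet β \ domSet α ∧ ∃ v ∈ domSet β \ domSet α, u < v ∧
      α.r (Sum.inl u) (Sum.inl v)}
    let B : Set (Fin n) := {u | u ∈ domSet β \ domSet α ∧ ∃ v ∈ domSet β \ domSet α, v < u ∧
      α.r (Sum.inl u) (Sum.inl v)}
    have hAB : A.ncard = B.ncard := by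
      refine Set.ncard_congr (fun u hu => Classical.choose hu.2) ?_ ?_ ?_
      · intro u hu
        have h1 := Classical.choose_spec hu.2
        exact ⟨h1.1, u, hu.1, h1.2.1, α.iseqv.symm h1.2.2⟩
      · intro u v hu hv huv
        have h1 := Classical.choose_spec hu.2
        have h2 := Classical.choose_spec hv.2
        have huv : Classical.choose hu.2 = Classical.choose hv.2 := huv
        rw [← huv] at h2
        rcases ll_ll hM.1 (α.iseqv.symm h1.2.2) (α.iseqv.symm h2.2.2) with h | h | h
        · omega
        · omega
        · exact h
      · rintro v ⟨hv, u, hu, huv, h⟩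
        have hA : u ∈ A := ⟨hu, v, hv, huv, α.iseqv.symm h⟩
        refine ⟨u, hA, ?_⟩
        have h1 := Classical.choose_spec hA.2
        rcases ll_ll hM.1 h1.2.2 (α.iseqv.symm h) with h | h | h
        · omega
        · omega
        · exact h
    have hS : domSet β \ domSet α = A ∪ B := by
      ext u
      constructor
      · intro hu
        obtain ⟨v, hv, hne, h⟩ := hpart u hu
        rcases lt_or_gt_of_ne hne with h' | h'
        · exact Or.inr ⟨hu, v, hv, h', h⟩
        · exact Or.inl ⟨hu, v, hv, h', h⟩
      · rintro (h | h)
        · exact h.1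
        · exact h.1
    have hdj : Disjoint A B := by
      rw [Set.disjoint_left]
      rintro a ⟨-, v, -, h1, h2⟩ ⟨-, w, -, h3, h4⟩
      rcases ll_ll hM.1 h2 h4 with h | h | h <;> omega
    rw [hS, Set.ncard_union_eq hdj (Set.toFinite _) (Set.toFinite _), ← hAB] at hScard
    omega
  obtain ⟨x, hx, hxs⟩ := hex
  refine ⟨x, hxs, ?_⟩
  rintro d ⟨u, v, c1, c2, c3, c4⟩
  have hnest : ∀ a b, β.r (Sum.inl a) (Sum.inl b) → a < x → x < b → False := by
    intro a b h h3 h4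
    obtain ⟨j, hj⟩ := hx.1
    exact hook_trans hB.2 h hj h3 h4
  have hu : ∀ i, u i ∈ domSet β \ domSet α := by
    intro i
    have hne : u i ≠ v i := ((c2 i).1.trans (c2 i).2).ne
    refine ⟨?_, hnd _ _ hne (c1 i)⟩
    by_contra hh
    exact hnest _ _ (hhook _ _ hne (c1 i) hh) (c2 i).1 (c2 i).2
  have hv : ∀ i, v i ∈ domSet β \ domSet α := by
    intro i
    have hne : v i ≠ u i := ((c2 i).1.trans (c2 i).2).ne'
    refine ⟨?_, hnd _ _ hne (α.iseqv.symm (c1 i))⟩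
    by_contra hh
    exact hnest _ _ (β.iseqv.symm (hhook _ _ hne (α.iseqv.symm (c1 i)) hh)) (c2 i).1 (c2 i).2
  have hcu : (Set.range u).ncard = d := by
    rw [← Set.image_univ, Set.ncard_image_of_injective _ c3.injective, Set.ncard_univ]; simp
  have hcv : (Set.range v).ncard = d := by
    rw [← Set.image_univ, Set.ncard_image_of_injective _ c4.injective, Set.ncard_univ]; simp
  have hdj : Disjoint (Set.range u) (Set.range v) := by
    rw [Set.disjoint_left]
    rintro _ ⟨i, rfl⟩ ⟨j, hj⟩
    have h3 := (c2 i).1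
    have h4 := (c2 j).2
    rw [hj] at h4
    exact lt_asymm h3 h4
  have hxn : x ∉ Set.range u ∪ Set.range v := by
    rintro (⟨i, hi⟩ | ⟨i, hi⟩)
    · have := (c2 i).1; rw [hi] at this; exact lt_irrefl _ this
    · have := (c2 i).2; rw [hi] at this; exact lt_irrefl _ this
  have hsub : insert x (Set.range u ∪ Set.range v) ⊆ domSet β \ domSet α := by
    rintro a (rfl | ⟨i, rfl⟩ | ⟨i, rfl⟩)
    · exact hx
    · exact hu i
    · exact hv i
  have := Set.ncard_le_ncard hsub (Set.toFinite _)
  rw [hScard, Set.ncard_insert_of_notMem hxn (Set.toFinite _),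
    Set.ncard_union_eq hdj (Set.toFinite _) (Set.toFinite _), hcu, hcv] at this
  omega

end Dgm

/-- For `0 ≤ s ≤ r ≤ n - 2` with `r ≢ s (mod 2)` and
`α ∈ D_s(M_n)`: `α ∈ ⟨D_r(M_n)⟩` iff `α` has a singleton upper block of
nesting depth at most `(r - s - 1)/2` and a singleton lower block of nesting
depth at most `(r - s - 1)/2`. -/
theorem mem_genSet_DM_iff (n r s : ℕ) (hsr : s ≤ r) (hrn : r + 2 ≤ n)
    (hpar : r % 2 ≠ s % 2) (α : Dgm n) (hα : α ∈ DM n s) :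
    α ∈ genSet (pmul (n := n)) (DM n r) ↔
      ((∃ x : Fin n, UpperSingleton α x ∧
          ∀ d : ℕ, UpperHookChain α x d → d ≤ (r - s - 1) / 2) ∧
       (∃ x : Fin n, LowerSingleton α x ∧
          ∀ d : ℕ, LowerHookChain α x d → d ≤ (r - s - 1) / 2)) := by
  constructor
  · intro h
    refine ⟨nec2 hsr hpar hα h, ?_⟩
    obtain ⟨x, h1, h2⟩ := nec2 hsr hpar (DM_star hα) (gen_star h)
    exact ⟨x, (US_star α x).1 h1, h2⟩
  · rintro ⟨⟨x, hx, hxd⟩, ⟨y, hy, hyd⟩⟩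
    have e : r = s + 2 * ((r - s - 1) / 2) + 1 := by omega
    rw [e]
    exact suff (by omega) hα x y hx hxd hy hyd
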